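/- Every infinite virtually cyclic group G contains a unique maximal finite normal subgroup C, and the quotient G/C is isomorphic either to the infinite cyclic group ℤ or to the infinite dihedral group D∞ = ℤ/2ℤ * ℤ/2ℤ. -/

import Mathlib

open Subgroup

/-- The homomorphism from the group of order two sending the generator to a given involution. -/
def involutionHom {M : Type*} [Monoid M] (s : M) (hs : s * s = 1) :
    Multiplicative (ZMod 2) →* M where
  toFun x := if x = 1 then 1 else s
  map_one' := if_pos rfl
  map_mul' x y := by
    have h : ∀ x : Multiplicative (ZMod 2), x = 1 ∨ x = .ofAdd 1 := by decide
    have h1 : (Multiplicative.ofAdd 1 : Multiplicative (ZMod 2)) ≠ 1 := by decide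
    have h2 : (Multiplicative.ofAdd 1 * .ofAdd 1 : Multiplicative (ZMod 2)) = 1 := by decide
    rcases h x with rfl | rfl <;> rcases h y with rfl | rfl <;> simp only [mul_one, one_mul,
      if_true, h1, h2, if_false, hs]

lemma involutionHom_ofAdd_one {M : Type*} [Monoid M] (s : M) (hs : s * s = 1) :
    involutionHom s hs (.ofAdd 1) = s :=
  if_neg (t := (1 : M)) (show (Multiplicative.ofAdd 1 : Multiplicative (ZMod 2)) ≠ 1 by decide)

lemma involutionHom_ext {M : Type*} [Monoid M] {f g : Multiplicative (ZMod 2) →* M}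
    (h : f (.ofAdd 1) = g (.ofAdd 1)) : f = g := by
  refine MonoidHom.ext fun x => ?_
  have hx : ∀ x : Multiplicative (ZMod 2), x = 1 ∨ x = .ofAdd 1 := by decide
  rcases hx x with rfl | rfl
  · simp only [map_one]
  · exact h

/-- The homomorphism from the infinite dihedral group determined by two involutions. -/
def DihedralGroup.liftInvolutions {M : Type*} [Group M] (a b : M) (ha : a * a = 1)
    (hb : b * b = 1) : DihedralGroup 0 →* M where
  toFun
    | .r i => (a * b) ^ (show ℤ from i)
    | .sr i => a * (a * b) ^ (show ℤ from i)
  map_one' := zpow_zero _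
  map_mul' := by
    have ha' : a⁻¹ = a := inv_eq_of_mul_eq_one_left ha
    have hb' : b⁻¹ = b := inv_eq_of_mul_eq_one_left hb
    have hconj (i : ℤ) : a * (a * b) ^ i * a = (a * b) ^ (-i) := by
      have h := map_zpow (MulAut.conj a) (a * b) i
      simp only [MulAut.conj_apply, ha'] at h
      rw [h, zpow_neg, ← inv_zpow, mul_inv_rev, ha', hb', ← mul_assoc a a b, ha, one_mul]
    have hconj' (i : ℤ) : (a * b) ^ i * a = a * (a * b) ^ (-i) := by
      rw [← hconj, ← mul_assoc, ← mul_assoc, ha, one_mul]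
    have hrsr (i j : ℤ) : a * (a * b) ^ (j - i) = (a * b) ^ i * (a * (a * b) ^ j) := by
      rw [← mul_assoc, hconj', mul_assoc, ← zpow_add, sub_eq_neg_add]
    have hsrr (i j : ℤ) : a * (a * b) ^ (i + j) = a * (a * b) ^ i * (a * b) ^ j := by
      rw [mul_assoc, zpow_add]
    have hsrsr (i j : ℤ) : (a * b) ^ (j - i) = a * (a * b) ^ i * (a * (a * b) ^ j) := by
      rw [← mul_assoc, hconj, ← zpow_add, sub_eq_neg_add]
    rintro (i | i) (j | j)
    · exact zpow_add (a * b) _ _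
    · exact hrsr i j
    · exact hsrr i j
    · exact hsrsr i j

lemma DihedralGroup.liftInvolutions_r {M : Type*} [Group M] (a b : M) (ha : a * a = 1)
    (hb : b * b = 1) (i : ℤ) : liftInvolutions a b ha hb (r i) = (a * b) ^ i :=
  rfl

lemma DihedralGroup.liftInvolutions_sr {M : Type*} [Group M] (a b : M) (ha : a * a = 1)
    (hb : b * b = 1) (i : ℤ) : liftInvolutions a b ha hb (sr i) = a * (a * b) ^ i :=
  rfl

/-- The infinite dihedral group is the free product of two groups of order two. -/
def DihedralGroup.zeroMulEquivCoprod :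
    DihedralGroup 0 ≃* Monoid.Coprod (Multiplicative (ZMod 2)) (Multiplicative (ZMod 2)) :=
  have hsq : (Multiplicative.ofAdd 1 * .ofAdd 1 : Multiplicative (ZMod 2)) = 1 := by decide
  MonoidHom.toMulEquiv
    (liftInvolutions (Monoid.Coprod.inl (.ofAdd 1)) (Monoid.Coprod.inr (.ofAdd 1))
      (by rw [← map_mul, hsq, map_one]) (by rw [← map_mul, hsq, map_one]))
    (Monoid.Coprod.lift (involutionHom (sr 0) (sr_mul_self 0))
      (involutionHom (sr 1) (sr_mul_self 1)))
    (by
      have hr (i : ℤ) : (r 1 : DihedralGroup 0) ^ i = r i := by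
        rw [r_zpow]; exact congrArg r (one_mul _)
      refine MonoidHom.ext ?_
      rintro ((i : ℤ) | (i : ℤ))
      · refine (congrArg (Monoid.Coprod.lift _ _)
          (liftInvolutions_r _ _ _ _ i)).trans ?_
        rw [map_zpow, map_mul, Monoid.Coprod.lift_apply_inl, Monoid.Coprod.lift_apply_inr,
          involutionHom_ofAdd_one, involutionHom_ofAdd_one, sr_mul_sr, sub_zero]
        exact hr i
      · refine (congrArg (Monoid.Coprod.lift _ _)
          (liftInvolutions_sr _ _ _ _ i)).trans ?_
        rw [map_mul, map_zpow, map_mul, Monoid.Coprod.lift_apply_inl,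
          Monoid.Coprod.lift_apply_inr, involutionHom_ofAdd_one, involutionHom_ofAdd_one,
          sr_mul_sr, sub_zero]
        refine (congrArg _ (hr i)).trans ?_
        exact congrArg sr (zero_add i))
    (by
      apply Monoid.Coprod.hom_ext <;> apply involutionHom_ext
      · simp only [MonoidHom.comp_apply, Monoid.Coprod.lift_apply_inl, involutionHom_ofAdd_one]
        refine (liftInvolutions_sr _ _ _ _ 0).trans ?_
        rw [zpow_zero, mul_one]
        rfl
      · simp only [MonoidHom.comp_apply, Monoid.Coprod.lift_apply_inr, involutionHom_ofAdd_one]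
        refine (liftInvolutions_sr _ _ _ _ 1).trans ?_
        rw [zpow_one, ← mul_assoc, ← map_mul, hsq, map_one, one_mul]
        rfl)

/-- A group with an infinite cyclic central subgroup of finite index is finite-by-`ℤ`. -/
lemma exists_surjective_int_finite_ker {K : Type*} [Group K] (N : Subgroup K) [IsCyclic N]
    [Infinite N] [N.FiniteIndex] (hN : N ≤ center K) :
    ∃ φ : K →* Multiplicative ℤ, Function.Surjective φ ∧ Finite φ.ker := by
  let e : Multiplicative ℤ ≃* N := intCyclicMulEquiv
  let ψ : K →* Multiplicative ℤ := MonoidHom.transfer (H := N) (e.symm : N →* Multiplicative ℤ)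
  have hψ (x : N) (hx : ψ x = 1) : x = 1 := by
    have key : ∀ (k : ℕ) (g₀ : K),
        g₀⁻¹ * (x : K) ^ k * g₀ ∈ N → g₀⁻¹ * (x : K) ^ k * g₀ = (x : K) ^ k := fun k g₀ _ => by
      rw [mul_assoc, ← mem_center_iff.1 (pow_mem (hN x.2) k) g₀, inv_mul_cancel_left]
    have h : ψ x = e.symm ⟨(x : K) ^ N.index, _⟩ := MonoidHom.transfer_eq_pow _ _ key
    have h' : (⟨(x : K) ^ N.index, MonoidHom.transfer_eq_pow_aux _ key⟩ : N) = x ^ N.index :=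
      rfl
    rw [h', map_pow] at h
    rw [hx, eq_comm, pow_eq_one_iff_left FiniteIndex.index_ne_zero] at h
    simpa using h
  have hinj : Function.Injective fun x : N => ψ.rangeRestrict x :=
    (injective_iff_map_eq_one (ψ.rangeRestrict.comp N.subtype)).2 fun x hx =>
      hψ x (congrArg Subtype.val hx)
  have : Infinite ψ.range := Infinite.of_injective _ hinj
  let e' : Multiplicative ℤ ≃* ψ.range := intCyclicMulEquiv
  have hker : Finite ψ.ker := by
    refine Finite.of_injective (fun x : ψ.ker => (QuotientGroup.mk x : K ⧸ N)) fun x y hxy => ?_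
    have hmem : (x : K)⁻¹ * y ∈ N := QuotientGroup.eq.1 hxy
    have := hψ ⟨_, hmem⟩ (ψ.ker.mul_mem (inv_mem x.2) y.2)
    exact Subtype.ext (inv_mul_eq_one.1 (congrArg Subtype.val this))
  refine ⟨(e'.symm : ψ.range →* Multiplicative ℤ).comp ψ.rangeRestrict,
    e'.symm.surjective.comp ψ.rangeRestrict_surjective, ?_⟩
  rwa [MonoidHom.ker_mulEquiv_comp, MonoidHom.ker_rangeRestrict]

/-- An epimorphism onto `ℤ` from an index two subgroup that is inverted by conjugation extends to
an epimorphism onto the infinite dihedral group. -/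
lemma exists_surjective_dihedralGroup_zero {G : Type*} [Group G] (K : Subgroup G)
    (φ : K →* Multiplicative ℤ) (hφ : Function.Surjective φ) (s : G) (hs : s ∉ K)
    (hK : ∀ a b, a ∉ K → b ∉ K → a * b ∈ K)
    (hconj : ∀ k k' : K, (k' : G) = s * k * s⁻¹ → φ k' = (φ k)⁻¹) :
    ∃ π : G →* DihedralGroup 0, Function.Surjective π ∧ π.ker = φ.ker.map K.subtype := by
  classical
  let f : K → ℤ := fun k => (φ k).toAdd
  have hmul (x y : K) : f (x * y) = f x + f y := by simp [f]
  have hinv (k k' : K) (h : (k' : G) = s * k * s⁻¹) : f k' = - f k := by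
    simp [f, hconj k k' h]
  have hs' : s⁻¹ ∉ K := by simpa using hs
  have hss : f ⟨s * s, hK s s hs hs⟩ = 0 := by
    have := hinv ⟨s * s, hK s s hs hs⟩ ⟨s * s, hK s s hs hs⟩ (by simp [mul_assoc])
    omega
  let F : G → DihedralGroup 0 := fun g =>
    if h : g ∈ K then .r (f ⟨g, h⟩)
    else .sr (f ⟨s⁻¹ * g, hK _ _ hs' h⟩)
  have F1 (k : K) : F k = .r (f k) := dif_pos k.2
  have hsk (k : K) : s * k ∉ K := fun h => hs ((K.mul_mem_cancel_right k.2).1 h)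
  have F2 (k : K) : F (s * k) = .sr (f k) := by
    simp only [F, dif_neg (hsk k)]
    congr 2
    exact Subtype.ext (inv_mul_cancel_left _ _)
  have hcases (g : G) : (∃ k : K, g = k) ∨ ∃ k : K, g = s * k := by
    by_cases h : g ∈ K
    · exact .inl ⟨⟨g, h⟩, rfl⟩
    · exact .inr ⟨⟨s⁻¹ * g, hK _ _ hs' h⟩, by simp⟩
  have hsks (k : K) : s * k * s⁻¹ ∈ K := hK _ _ (hsk k) hs'
  have hsks' (k : K) : s⁻¹ * k * s ∈ K :=
    hK _ _ (fun h => hs' ((K.mul_mem_cancel_right k.2).1 h)) hs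
  have hF (a b : G) : F (a * b) = F a * F b := by
    rcases hcases a with ⟨x, rfl⟩ | ⟨x, rfl⟩ <;> rcases hcases b with ⟨y, rfl⟩ | ⟨y, rfl⟩
    · rw [F1, F1, ← K.coe_mul, F1, hmul]; rfl
    · have h1 : (x : G) * (s * y) = s * ((⟨_, hsks' x⟩ * y : K) : G) := by
        simp [mul_assoc]
      have h2 := hinv ⟨_, hsks' x⟩ x (by simp [mul_assoc])
      rw [F1, F2, h1, F2, hmul]
      exact congrArg DihedralGroup.sr (by omega : _ + _ = f y - f x)
    · rw [F1, F2, mul_assoc, ← K.coe_mul, F2, hmul]; rfl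
    · have h1 : s * x * (s * y) = ((⟨_, hsks x⟩ * ⟨_, hK s s hs hs⟩ * y : K) : G) := by
        simp [mul_assoc]
      have h2 := hinv x ⟨_, hsks x⟩ rfl
      rw [F2, F2, h1, F1, hmul, hmul]
      exact congrArg DihedralGroup.r (by omega : _ + _ + _ = f y - f x)
  refine ⟨MonoidHom.mk' F hF, ?_, ?_⟩
  · rintro (i | i)
    · obtain ⟨k, hk⟩ := hφ (.ofAdd (i : ℤ))
      exact ⟨k, (F1 k).trans (congrArg _ (congrArg Multiplicative.toAdd hk))⟩
    · obtain ⟨k, hk⟩ := hφ (.ofAdd (i : ℤ))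
      exact ⟨s * k, (F2 k).trans (congrArg _ (congrArg Multiplicative.toAdd hk))⟩
  · ext g
    simp only [MonoidHom.mem_ker, MonoidHom.mk'_apply, Subgroup.mem_map, Subgroup.coe_subtype]
    constructor
    · intro hg
      rcases hcases g with ⟨k, rfl⟩ | ⟨k, rfl⟩
      · rw [F1, DihedralGroup.one_def] at hg
        exact ⟨k, Multiplicative.toAdd.injective (DihedralGroup.r.inj hg), rfl⟩
      · rw [F2, DihedralGroup.one_def] at hg
        cases hg
    · rintro ⟨k, hk, rfl⟩
      rw [F1, DihedralGroup.one_def]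
      exact congrArg _ (congrArg Multiplicative.toAdd hk)

/-- A homomorphism to `ℤ` from a group commensurable with `⟨t⟩` is inverted by any automorphism
inverting `t`. -/
lemma map_conj_eq_inv {G : Type*} [Group G] {K : Subgroup G} (φ : K →* Multiplicative ℤ)
    {t s : G} (htK : t ∈ K) (hst : s * t * s⁻¹ = t⁻¹) [(zpowers t).FiniteIndex]
    (k k' : K) (h : (k' : G) = s * k * s⁻¹) : φ k' = (φ k)⁻¹ := by
  obtain ⟨n, hn, -, hmem⟩ :=
    exists_pow_mem_of_index_ne_zero (H := zpowers t) FiniteIndex.index_ne_zero (k : G)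
  obtain ⟨m, hm⟩ := mem_zpowers_iff.1 hmem
  have h1 : k ^ n = (⟨t, htK⟩ : K) ^ m := Subtype.ext (by simp [hm])
  have h2 : k' ^ n = ((⟨t, htK⟩ : K) ^ m)⁻¹ := Subtype.ext (by
    simp [h, conj_pow, ← hm, ← conj_zpow, hst])
  apply pow_left_injective hn.ne'
  change φ k' ^ n = (φ k)⁻¹ ^ n
  rw [inv_pow, ← map_pow, ← map_pow, h1, h2, map_inv]

lemma conj_eq_self_or_inv_of_normal_zpowers {G : Type*} [Group G] {t : G}
    (ht : ¬IsOfFinOrder t) (hN : (zpowers t).Normal) (g : G) :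
    g * t * g⁻¹ = t ∨ g * t * g⁻¹ = t⁻¹ := by
  obtain ⟨k, hk⟩ := mem_zpowers_iff.1 (hN.conj_mem t (mem_zpowers t) g)
  obtain ⟨l, hl⟩ := mem_zpowers_iff.1 (hN.conj_mem t (mem_zpowers t) g⁻¹)
  have h : t ^ (k * l) = t ^ (1 : ℤ) := by
    rw [zpow_mul, hk, conj_zpow, hl]
    simp [mul_assoc]
  rcases Int.eq_one_or_neg_one_of_mul_eq_one (injective_zpow_iff_not_isOfFinOrder.2 ht h) with
    rfl | rfl
  · exact .inl (by rw [← hk, zpow_one])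
  · exact .inr (by rw [← hk, zpow_neg_one])


/-- Every infinite virtually cyclic group `G` contains a unique maximal finite normal
subgroup `C`, and the quotient `G/C` is isomorphic either to `ℤ` or to the infinite
dihedral group `D∞ = ℤ/2ℤ * ℤ/2ℤ` (expressed via a surjective homomorphism with kernel `C`). -/
theorem stmt_0 (G : Type*) [Group G] [Infinite G]
    (hvc : ∃ H : Subgroup G, IsCyclic H ∧ H.FiniteIndex) :
    ∃ C : Subgroup G,
      (C.Normal ∧ Finite C ∧ ∀ D : Subgroup G, D.Normal → Finite D → D ≤ C) ∧
      (∀ C' : Subgroup G,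
        (C'.Normal ∧ Finite C' ∧ ∀ D : Subgroup G, D.Normal → Finite D → D ≤ C') → C' = C) ∧
      ((∃ π : G →* Multiplicative ℤ, Function.Surjective π ∧ π.ker = C) ∨
        (∃ π : G →* Monoid.Coprod (Multiplicative (ZMod 2)) (Multiplicative (ZMod 2)),
          Function.Surjective π ∧ π.ker = C)) := by
  obtain ⟨H, hcyc, hfin⟩ := hvc
  have : IsCyclic H.normalCore := isCyclic_of_le H.normalCore_le
  obtain ⟨t, hNt⟩ := H.normalCore.isCyclic_iff_exists_zpowers_eq_top.1 this
  have hN : (zpowers t).Normal := hNt ▸ H.normalCore_normal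
  have hfi : (zpowers t).FiniteIndex := hNt ▸ inferInstance
  have ht : ¬IsOfFinOrder t := fun h => by
    have : Finite (zpowers t) := h.finite_zpowers
    exact not_finite_iff_infinite.2 ‹_›
      ((finite_iff_finite_and_finiteIndex (zpowers t)).2 ⟨this, hfi⟩)
  have hconj := conj_eq_self_or_inv_of_normal_zpowers ht hN
  let K := centralizer {t}
  have hK (g : G) : g ∈ K ↔ g * t * g⁻¹ = t := by
    rw [mem_centralizer_singleton_iff, mul_inv_eq_iff_eq_mul]
  have htK : t ∈ K := (hK t).2 (by simp)
  have hle : zpowers t ≤ K := zpowers_le.2 htK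
  have hinvert (g : G) (hg : g ∉ K) : g * t * g⁻¹ = t⁻¹ :=
    (hconj g).resolve_left fun h => hg ((hK g).2 h)
  have hKmul (a b : G) (ha : a ∉ K) (hb : b ∉ K) : a * b ∈ K := by
    rw [hK]
    calc a * b * t * (a * b)⁻¹ = a * (b * t * b⁻¹) * a⁻¹ := by group
      _ = (a * t * a⁻¹)⁻¹ := by rw [hinvert b hb]; group
      _ = t := by rw [hinvert a ha, inv_inv]
  let e := subgroupOfEquivOfLe hle
  have : Infinite (zpowers t) := infinite_zpowers.2 ht |>.to_subtype
  have : Infinite ((zpowers t).subgroupOf K) := Infinite.of_injective e.symm e.symm.injective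
  have : IsCyclic ((zpowers t).subgroupOf K) := isCyclic_of_surjective e.symm e.symm.surjective
  obtain ⟨φ, hφ, hker⟩ := exists_surjective_int_finite_ker ((zpowers t).subgroupOf K) (by
    rintro x hx
    obtain ⟨m, hm⟩ := mem_zpowers_iff.1 (mem_subgroupOf.1 hx)
    refine mem_center_iff.2 fun g => Subtype.ext ?_
    have : Commute (g : G) t := mem_centralizer_singleton_iff.1 g.2
    simpa [← hm] using (this.zpow_right m).eq)
  have hmax (D : Subgroup G) (hD : D.Normal) (hDfin : Finite D) : D ≤ φ.ker.map K.subtype := by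
    have htors (x : G) (hx : x ∈ D) : IsOfFinOrder x :=
      Submonoid.isOfFinOrder_coe.2 (isOfFinOrder_of_finite (⟨x, hx⟩ : D))
    intro d hd
    have hdK : d ∈ K := by
      by_contra h
      have hmem : t * t ∈ D := by
        have := D.mul_mem (hD.conj_mem d hd t) (D.inv_mem hd)
        rwa [show t * d * t⁻¹ * d⁻¹ = t * (d * t * d⁻¹)⁻¹ by group, hinvert d h, inv_inv] at this
      exact ht (IsOfFinOrder.of_pow (pow_two t ▸ htors _ hmem) two_ne_zero)
    refine ⟨⟨d, hdK⟩, ?_, rfl⟩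
    obtain ⟨n, hn, hdn⟩ := isOfFinOrder_iff_pow_eq_one.1 (htors d hd)
    have : (⟨d, hdK⟩ : K) ^ n = 1 := Subtype.ext hdn
    have := congrArg φ this
    rw [map_pow, map_one] at this
    exact (pow_eq_one_iff_left hn.ne').1 this
  have hquot : (∃ π : G →* Multiplicative ℤ,
        Function.Surjective π ∧ π.ker = φ.ker.map K.subtype) ∨
      ∃ π : G →* Monoid.Coprod (Multiplicative (ZMod 2)) (Multiplicative (ZMod 2)),
        Function.Surjective π ∧ π.ker = φ.ker.map K.subtype := by
    by_cases hall : ∀ g, g ∈ K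
    · let ι : G →* K := (MonoidHom.id G).codRestrict K hall
      refine .inl ⟨φ.comp ι, fun z => ?_, ?_⟩
      · obtain ⟨k, rfl⟩ := hφ z
        exact ⟨k, rfl⟩
      · ext g
        exact ⟨fun h => ⟨ι g, h, rfl⟩, by rintro ⟨k, hk, rfl⟩; exact hk⟩
    · obtain ⟨s, hs⟩ := not_forall.1 hall
      obtain ⟨π, hπ, hπker⟩ := exists_surjective_dihedralGroup_zero K φ hφ s hs hKmul
        (map_conj_eq_inv φ htK (hinvert s hs))
      refine .inr ⟨(DihedralGroup.zeroMulEquivCoprod : DihedralGroup 0 →* _).comp π,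
        DihedralGroup.zeroMulEquivCoprod.surjective.comp hπ, ?_⟩
      rw [MonoidHom.ker_mulEquiv_comp, hπker]
  have hnormal : (φ.ker.map K.subtype).Normal := by
    rcases hquot with ⟨π, -, h⟩ | ⟨π, -, h⟩ <;> exact h ▸ π.normal_ker
  have hfinite : Finite (φ.ker.map K.subtype) := Set.Finite.image _ (Set.toFinite (φ.ker : Set K))
  exact ⟨_, ⟨hnormal, hfinite, hmax⟩, fun C' ⟨h1, h2, h3⟩ =>
    le_antisymm (hmax C' h1 h2) (h3 _ hnormal hfinite), hquot⟩
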